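/- arXiv:2102.05301 — 4 statements merged into one kernel-verified Lean document; each statement's English description precedes it below -/
import Mathlib

section
/- Let T be a spanning tree of a finite connected weighted graph G rooted at r, and let e and e' be distinct tree edges with e' a descendant of e (so Subtree(e') ⊊ Subtree(e)). Let S = Subtree(e) ∖ Subtree(e'). Then the set of crossing edges of the cut given by S is exactly the symmetric difference F_e Δ F_{e'}, and hence the weight of this cut equals w(F_e) + w(F_{e'}) − 2·w(F_e ∩ F_{e'}). -/
open SimpleGraph

/-- The crossing edges of the cut `S`: edges of `G` with exactly one endpoint in `S`. -/
def crossEdges {V : Type*} (G : SimpleGraph V) (S : Set V) : Set (Sym2 V) :=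
  {f | f ∈ G.edgeSet ∧ ∃ x y, f = s(x, y) ∧ x ∈ S ∧ y ∉ S}

/-- The total weight of a set of edges. -/
noncomputable def wSet {V : Type*} (w : Sym2 V → ℝ) (F : Set (Sym2 V)) : ℝ :=
  ∑ᶠ f ∈ F, w f

/-- The weight of the cut `S`. -/
noncomputable def cutWeight {V : Type*} (G : SimpleGraph V) (w : Sym2 V → ℝ) (S : Set V) : ℝ :=
  wSet w (crossEdges G S)

/-- The minimum cut weight of `G`: the minimum of `cutWeight` over all `S` with `∅ ⊊ S ⊊ V`. -/
noncomputable def minCut {V : Type*} (G : SimpleGraph V) (w : Sym2 V → ℝ) : ℝ :=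
  sInf (cutWeight G w '' {S : Set V | S.Nonempty ∧ S ≠ Set.univ})

/-- `F_e`: the set of edges `{x, y}` of `G` (tree and non-tree) whose unique path in `T`
between `x` and `y` contains the tree edge `e`. -/
def Fe {V : Type*} (G T : SimpleGraph V) (e : Sym2 V) : Set (Sym2 V) :=
  {f | f ∈ G.edgeSet ∧ ∃ x y, f = s(x, y) ∧ ∃ p : T.Walk x y, p.IsPath ∧ e ∈ p.edges}

/-- `Subtree(e)`: the vertices whose unique path in `T` to the root `r` passes through the
tree edge `e`; equivalently, the vertex set of the subtree of `T` rooted at the endpoint of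
`e` farther from `r`. -/
def subtree {V : Type*} (T : SimpleGraph V) (r : V) (e : Sym2 V) : Set V :=
  {x | ∃ p : T.Walk x r, p.IsPath ∧ e ∈ p.edges}

/-- In a tree, the path from `x` to `y` contains `e` iff `e` separates `x` from `y`. -/
lemma path_mem_iff {V : Type*} {T : SimpleGraph V} (hT : T.IsTree) (e : Sym2 V) (x y : V) :
    (∃ p : T.Walk x y, p.IsPath ∧ e ∈ p.edges) ↔ ¬ (T.deleteEdges {e}).Reachable x y := by
  classical
  induction e with | _ a b
  rw [reachable_deleteEdges_iff_exists_walk]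
  constructor
  · rintro ⟨p, hp, he⟩ ⟨q, hq⟩
    have h : q.bypass = p := (hT.existsUnique_path x y).unique q.bypass_isPath hp
    exact hq (q.edges_bypass_subset (h ▸ he))
  · intro h
    obtain ⟨p, hp⟩ := (hT.existsUnique_path x y).exists
    refine ⟨p, hp, ?_⟩
    by_contra hc
    exact h ⟨p, hc⟩

/-- Deleting one edge from a connected graph leaves at most two components. -/
lemma two_comp {V : Type*} {T : SimpleGraph V} (a b x c : V) (p : T.Walk x c) (hc : c = a) :
    (T.deleteEdges {s(a, b)}).Reachable x a ∨ (T.deleteEdges {s(a, b)}).Reachable x b := by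
  induction p with
  | nil => subst hc; exact Or.inl (Reachable.refl _)
  | @cons u v _ h q ih =>
    by_cases hE : s(u, v) = s(a, b)
    · rcases Sym2.eq_iff.1 hE with ⟨rfl, _⟩ | ⟨rfl, _⟩
      · exact Or.inl (Reachable.refl _)
      · exact Or.inr (Reachable.refl _)
    · have hA : (T.deleteEdges {s(a, b)}).Adj u v := by
        rw [deleteEdges_adj]; exact ⟨h, hE⟩
      exact (ih hc).imp hA.reachable.trans hA.reachable.trans

/-- The path from `x` to `y` contains `e` iff exactly one endpoint is in the subtree. -/
lemma path_iff_subtree {V : Type*} {T : SimpleGraph V} (hT : T.IsTree) (r : V) (e : Sym2 V)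
    (he : e ∈ T.edgeSet) (x y : V) :
    (∃ p : T.Walk x y, p.IsPath ∧ e ∈ p.edges) ↔
      ¬ (x ∈ subtree T r e ↔ y ∈ subtree T r e) := by
  simp only [subtree, Set.mem_setOf_eq, path_mem_iff hT]
  rw [not_iff_not, not_iff_not]
  constructor
  · intro h
    exact ⟨fun h' => h.symm.trans h', fun h' => h.trans h'⟩
  · intro h
    by_cases hx : (T.deleteEdges {e}).Reachable x r
    · exact hx.trans (h.1 hx).symm
    · have hy : ¬ (T.deleteEdges {e}).Reachable y r := fun h' => hx (h.2 h')
      induction e with | _ a b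
      have key : ∀ z, (T.deleteEdges {s(a, b)}).Reachable z a ∨
          (T.deleteEdges {s(a, b)}).Reachable z b := fun z =>
        two_comp a b z a (hT.connected.preconnected z a).some rfl
      rcases key x with h1 | h1 <;> rcases key y with h2 | h2 <;> rcases key r with h3 | h3
      all_goals first
        | exact h1.trans h2.symm
        | exact absurd (h1.trans h3.symm) hx
        | exact absurd (h2.trans h3.symm) hy

lemma mem_Fe_iff {V : Type*} {G T : SimpleGraph V} (hT : T.IsTree) (r : V) (e : Sym2 V)
    (he : e ∈ T.edgeSet) (x y : V) :
    s(x, y) ∈ Fe G T e ↔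
      G.Adj x y ∧ ¬ (x ∈ subtree T r e ↔ y ∈ subtree T r e) := by
  simp only [Fe, Set.mem_setOf_eq, path_iff_subtree hT r e he, mem_edgeSet]
  refine and_congr_right fun _ => ⟨?_, fun h => ⟨x, y, rfl, h⟩⟩
  rintro ⟨u, v, h, h'⟩
  rcases Sym2.eq_iff.1 h with ⟨rfl, rfl⟩ | ⟨rfl, rfl⟩ <;> tauto

lemma mem_crossEdges_iff {V : Type*} {G : SimpleGraph V} (S : Set V) (x y : V) :
    s(x, y) ∈ crossEdges G S ↔ G.Adj x y ∧ ¬ (x ∈ S ↔ y ∈ S) := by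
  simp only [crossEdges, Set.mem_setOf_eq, mem_edgeSet]
  refine and_congr_right fun _ => ⟨?_, fun h => ?_⟩
  · rintro ⟨u, v, h, h'⟩
    rcases Sym2.eq_iff.1 h with ⟨rfl, rfl⟩ | ⟨rfl, rfl⟩ <;> tauto
  · by_cases hx : x ∈ S
    · exact ⟨x, y, rfl, hx, by tauto⟩
    · exact ⟨y, x, Sym2.eq_swap, by tauto, hx⟩

theorem stmt1 {V : Type*} [Fintype V] (G T : SimpleGraph V) (w : Sym2 V → ℝ)
    (hw : ∀ f, 0 ≤ w f) (hG : G.Connected) (hTG : T ≤ G) (hT : T.IsTree)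
    (r : V) (e e' : Sym2 V) (he : e ∈ T.edgeSet) (he' : e' ∈ T.edgeSet)
    (hne : e ≠ e') (hdesc : subtree T r e' ⊆ subtree T r e) :
    crossEdges G (subtree T r e \ subtree T r e') = symmDiff (Fe G T e) (Fe G T e') ∧
    cutWeight G w (subtree T r e \ subtree T r e') =
      wSet w (Fe G T e) + wSet w (Fe G T e') - 2 * wSet w (Fe G T e ∩ Fe G T e') := by
  have h1 : crossEdges G (subtree T r e \ subtree T r e') =
      symmDiff (Fe G T e) (Fe G T e') := by
    ext f
    induction f with | _ x y
    rw [Set.mem_symmDiff, mem_crossEdges_iff, mem_Fe_iff hT r e he, mem_Fe_iff hT r e' he',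
      Set.mem_diff, Set.mem_diff]
    have hx := @hdesc x
    have hy := @hdesc y
    tauto
  refine ⟨h1, ?_⟩
  have key : ∀ A B : Set (Sym2 V), wSet w (A ∩ B) + wSet w (A \ B) = wSet w A := fun A B =>
    finsum_mem_inter_add_sdiff B (Set.toFinite A)
  have h2 : wSet w (symmDiff (Fe G T e) (Fe G T e')) =
      wSet w (Fe G T e \ Fe G T e') + wSet w (Fe G T e' \ Fe G T e) :=
    finsum_mem_union disjoint_sdiff_sdiff (Set.toFinite _) (Set.toFinite _)
  have h3 := key (Fe G T e) (Fe G T e')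
  have h4 := key (Fe G T e') (Fe G T e)
  rw [Set.inter_comm] at h4
  rw [cutWeight, h1, h2]
  linarith
end

section
/- Let G be a finite undirected graph with m edges, positive real edge weights w, and minimum cut weight c > 0. Let s > 0 satisfy s·m ≤ c/2. Form G' from G by deleting every edge of weight less than s and assigning each remaining edge e the integer weight w'(e) = ⌊w(e)/s⌋. Then every vertex set S' that attains the minimum cut weight of G' under w' satisfies w_G(S') ≤ 2c; that is, the minimum cut of the transformed graph is a 2-approximate minimum cut of G. -/
open SimpleGraph

theorem stmt14 {V : Type*} [Fintype V] (G : SimpleGraph V) (w : Sym2 V → ℝ)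
    (hw : ∀ f ∈ G.edgeSet, 0 < w f) (hc : 0 < minCut G w)
    (s : ℝ) (hs : 0 < s) (hsm : s * G.edgeSet.ncard ≤ minCut G w / 2) :
    ∀ S' : Set V, S'.Nonempty → S' ≠ Set.univ →
      cutWeight (G.deleteEdges {f | w f < s}) (fun f => ((⌊w f / s⌋ : ℤ) : ℝ)) S' =
        minCut (G.deleteEdges {f | w f < s}) (fun f => ((⌊w f / s⌋ : ℤ) : ℝ)) →
      cutWeight G w S' ≤ 2 * minCut G w := by
  classical
  intro S' hne huniv hmin
  have hfin : ∀ F : Set (Sym2 V), F.Finite := fun F => Set.toFinite F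
  -- the transformed cut weight as a sum over the crossing edges of `G`
  have hcut : ∀ S : Set V,
      cutWeight (G.deleteEdges {f | w f < s}) (fun f => ((⌊w f / s⌋ : ℤ) : ℝ)) S =
        ∑ f ∈ (hfin (crossEdges G S)).toFinset, ((⌊w f / s⌋ : ℤ) : ℝ) := by
    intro S
    unfold cutWeight wSet
    rw [finsum_mem_eq_finite_toFinset_sum _ (hfin _)]
    apply Finset.sum_subset
    · intro f hf
      simp only [Set.Finite.mem_toFinset, crossEdges, edgeSet_deleteEdges,
        Set.mem_ofPred_eq] at hf ⊢
      exact ⟨hf.1.1, hf.2⟩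
    · intro f hf hf'
      simp only [Set.Finite.mem_toFinset, crossEdges, edgeSet_deleteEdges,
        Set.mem_ofPred_eq] at hf hf'
      have hlt : w f < s := by
        by_contra h
        exact hf' ⟨⟨hf.1, h⟩, hf.2⟩
      have h0 : ⌊w f / s⌋ = 0 := by
        rw [Int.floor_eq_zero_iff]
        exact ⟨div_nonneg (hw f hf.1).le hs.le, (div_lt_one hs).2 hlt⟩
      simp [h0]
  have hcutG : ∀ S : Set V,
      cutWeight G w S = ∑ f ∈ (hfin (crossEdges G S)).toFinset, w f := by
    intro S
    unfold cutWeight wSet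
    rw [finsum_mem_eq_finite_toFinset_sum _ (hfin _)]
  have hlow : ∀ S : Set V,
      s * cutWeight (G.deleteEdges {f | w f < s}) (fun f => ((⌊w f / s⌋ : ℤ) : ℝ)) S
        ≤ cutWeight G w S := by
    intro S
    rw [hcut, hcutG, Finset.mul_sum]
    apply Finset.sum_le_sum
    intro f _
    have := Int.floor_le (w f / s)
    rw [le_div_iff₀ hs] at this
    linarith
  have hup : cutWeight G w S' ≤
      s * cutWeight (G.deleteEdges {f | w f < s}) (fun f => ((⌊w f / s⌋ : ℤ) : ℝ)) S'
        + s * G.edgeSet.ncard := by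
    have hcard : ((hfin (crossEdges G S')).toFinset.card : ℝ) ≤ G.edgeSet.ncard := by
      rw [← Set.ncard_eq_toFinset_card _ (hfin _)]
      have hsub : crossEdges G S' ⊆ G.edgeSet := fun f hf => hf.1
      exact_mod_cast Set.ncard_le_ncard hsub (hfin _)
    have h1 : cutWeight G w S' ≤ ∑ f ∈ (hfin (crossEdges G S')).toFinset,
        (s * ((⌊w f / s⌋ : ℤ) : ℝ) + s) := by
      rw [hcutG]
      apply Finset.sum_le_sum
      intro f _
      have := (Int.lt_floor_add_one (w f / s)).le
      rw [div_le_iff₀ hs] at this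
      linarith
    rw [Finset.sum_add_distrib, ← Finset.mul_sum, ← hcut, Finset.sum_const,
      nsmul_eq_mul] at h1
    nlinarith
  have hbdd : BddBelow (cutWeight (G.deleteEdges {f | w f < s})
      (fun f => ((⌊w f / s⌋ : ℤ) : ℝ)) '' {S : Set V | S.Nonempty ∧ S ≠ Set.univ}) :=
    (Set.toFinite _).bddBelow
  have key : cutWeight G w S' - minCut G w / 2 ≤ minCut G w := by
    conv_rhs => unfold minCut
    apply le_csInf
    · exact ⟨_, S', ⟨hne, huniv⟩, rfl⟩
    · rintro _ ⟨S, hS, rfl⟩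
      have h2 : cutWeight (G.deleteEdges {f | w f < s})
          (fun f => ((⌊w f / s⌋ : ℤ) : ℝ)) S' ≤
          cutWeight (G.deleteEdges {f | w f < s}) (fun f => ((⌊w f / s⌋ : ℤ) : ℝ)) S := by
        rw [hmin]
        exact csInf_le hbdd ⟨S, hS, rfl⟩
      have h3 := mul_le_mul_of_nonneg_left h2 hs.le
      have h4 := hlow S
      linarith
  linarith
end

section
/- Let T be a finite tree with real edge weights and let S be a set of k ≥ 2 of its vertices. Then there exists a tree T_c with real edge weights, having fewer than 2k vertices, whose vertex set contains S, such that for every pair of vertices u, v ∈ S, the minimum edge weight on the unique path between u and v in T_c equals the minimum edge weight on the unique path between u and v in T. -/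
open SimpleGraph

theorem build_tree {V : Type*} (W : Sym2 V → ℝ)
    (hW : ∀ u v x, u ≠ v → v ≠ x → u ≠ x → min (W s(u,v)) (W s(v,x)) ≤ W s(u,x))
    (S : Finset V) :
    ∃ G : SimpleGraph V, G.IsAcyclic ∧ (∀ u v, G.Adj u v → u ∈ S ∧ v ∈ S) ∧
      ∀ u ∈ S, ∀ v ∈ S, u ≠ v → ∃ p : G.Walk u v, p.IsPath ∧
        IsLeast {x : ℝ | ∃ f ∈ p.edges, W f = x} (W s(u,v)) := by
  classical
  induction S using Finset.induction_on with
  | empty => exact ⟨⊥, isAcyclic_bot, by simp, by simp⟩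
  | insert a S ha ih =>
    obtain ⟨G, hG, hGS, hp⟩ := ih
    rcases S.eq_empty_or_nonempty with rfl | hne
    · exact ⟨⊥, isAcyclic_bot, by simp, by
        intro u hu v hv; simp at hu hv; simp [hu, hv]⟩
    obtain ⟨b, hb, hmax⟩ := S.exists_max_image (fun b => W s(a, b)) hne
    have hab : a ≠ b := fun h => ha (h ▸ hb)
    have hnr : ¬ G.Reachable a b := by
      rintro ⟨p⟩
      cases p with
      | nil => exact hab rfl
      | cons h _ => exact ha (hGS _ _ h).1
    have hle : G ≤ G ⊔ edge a b := le_sup_left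
    have hadj : (G ⊔ edge a b).Adj a b := by
      right; rw [edge_adj]; exact ⟨Or.inl ⟨rfl, rfl⟩, hab⟩
    -- paths from `a`
    have key : ∀ v ∈ S, ∃ p : (G ⊔ edge a b).Walk a v, p.IsPath ∧
        IsLeast {x : ℝ | ∃ f ∈ p.edges, W f = x} (W s(a,v)) := by
      intro v hv
      by_cases hbv : b = v
      · subst hbv
        refine ⟨Walk.cons hadj Walk.nil, by simp [hab], by simp, ?_⟩
        rintro x ⟨f, hf, rfl⟩
        simp at hf
        rw [hf]
      · obtain ⟨p, hpp, hl⟩ := hp b hb v hv hbv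
        have hav : a ≠ v := fun h => ha (h ▸ hv)
        have h1 := hW a b v hab hbv hav
        have h2 := hW b a v hab.symm hav hbv
        have h3 := hmax v hv
        rw [Sym2.eq_swap (a := b) (b := a), min_eq_right h3] at h2
        have h4 : W s(a,v) = min (W s(a,b)) (W s(b,v)) := le_antisymm (le_min h3 h2) h1
        have hsup : a ∉ p.support := by
          intro h
          exact hnr ⟨(p.takeUntil a h).reverse⟩
        refine ⟨Walk.cons hadj (p.mapLe hle), ?_, ?_, ?_⟩
        · rw [Walk.cons_isPath_iff]
          exact ⟨hpp.mapLe hle, by simpa using hsup⟩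
        · simp only [Walk.edges_cons, Walk.edges_mapLe_eq_edges]
          rcases min_choice (W s(a,b)) (W s(b,v)) with h | h
          · exact ⟨s(a,b), by simp, by rw [h4, h]⟩
          · obtain ⟨f, hf, hfe⟩ := hl.1
            exact ⟨f, by simp [hf], by rw [h4, h, hfe]⟩
        · rintro x ⟨f, hf, rfl⟩
          simp only [Walk.edges_cons, Walk.edges_mapLe_eq_edges, List.mem_cons] at hf
          rcases hf with rfl | hf
          · exact h3
          · exact h2.trans (hl.2 ⟨f, hf, rfl⟩)
    refine ⟨G ⊔ edge a b, ?_, ?_, ?_⟩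
    · exact hG.sup_edge_of_not_reachable hnr
    · intro u v h
      rcases h with h | h
      · have := hGS _ _ h
        simp [this]
      · rw [edge_adj] at h
        rcases h.1 with ⟨rfl, rfl⟩ | ⟨rfl, rfl⟩ <;> simp [hb]
    · intro u hu v hv huv
      rw [Finset.mem_insert] at hu hv
      rcases hu with rfl | hu
      · rcases hv with rfl | hv
        · exact absurd rfl huv
        · exact key v hv
      · rcases hv with rfl | hv
        · obtain ⟨p, hpp, hl⟩ := key u hu
          refine ⟨p.reverse, hpp.reverse, ?_⟩
          rw [Sym2.eq_swap]
          simpa using hl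
        · obtain ⟨p, hpp, hl⟩ := hp u hu v hv huv
          exact ⟨p.mapLe hle, hpp.mapLe hle, by simpa using hl⟩

theorem stmt16 {V : Type*} [Fintype V] (T : SimpleGraph V) (hT : T.IsTree)
    (w : Sym2 V → ℝ) (S : Finset V) (hk : 2 ≤ S.card) :
    ∃ (U : Finset V) (hSU : S ⊆ U) (Tc : SimpleGraph U) (wc : Sym2 U → ℝ),
      Tc.IsTree ∧ U.card < 2 * S.card ∧
      ∀ (u v : V) (hu : u ∈ S) (hv : v ∈ S),
        ∀ (p : T.Walk u v) (q : Tc.Walk ⟨u, hSU hu⟩ ⟨v, hSU hv⟩),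
          p.IsPath → q.IsPath →
          sInf {x : ℝ | ∃ f ∈ p.edges, w f = x} =
            sInf {x : ℝ | ∃ f ∈ q.edges, wc f = x} := by
  classical
  have hfin : ∀ {u v : V} (p : T.Walk u v), {x : ℝ | ∃ f ∈ p.edges, w f = x}.Finite := by
    intro u v p
    exact (List.finite_toSet p.edges).image w
  have hne : ∀ {u v : V} (p : T.Walk u v), u ≠ v →
      {x : ℝ | ∃ f ∈ p.edges, w f = x}.Nonempty := by
    intro u v p huv
    cases p with
    | nil => exact absurd rfl huv
    | cons h p => exact ⟨_, _, by rw [Walk.edges_cons]; exact List.mem_cons_self, rfl⟩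
  choose P hP using fun u v => (hT.existsUnique_path u v).exists
  have huniq : ∀ {u v : V} (p : T.Walk u v), p.IsPath → p = P u v := fun p hp =>
    (hT.existsUnique_path _ _).unique hp (hP _ _)
  let m : V → V → ℝ := fun u v => sInf {x : ℝ | ∃ f ∈ (P u v).edges, w f = x}
  have hm : ∀ u v, m u v = m v u := by
    intro u v
    simp only [m]
    rw [← huniq _ (hP v u).reverse]
    simp
  let W : Sym2 V → ℝ := Sym2.lift ⟨m, hm⟩
  have hWm : ∀ u v, W s(u,v) = m u v := fun u v => rfl
  have hW : ∀ u v x, u ≠ v → v ≠ x → u ≠ x →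
      min (W s(u,v)) (W s(v,x)) ≤ W s(u,x) := by
    intro u v x _ _ hux
    simp only [hWm]
    refine le_csInf (hne _ hux) ?_
    rintro y ⟨f, hf, rfl⟩
    rw [← huniq _ ((P u v).append (P v x)).bypass_isPath] at hf
    have hf := Walk.edges_bypass_subset _ hf
    rw [Walk.edges_append, List.mem_append] at hf
    rcases hf with hf | hf
    · exact (min_le_left _ _).trans (csInf_le (hfin _).bddBelow ⟨f, hf, rfl⟩)
    · exact (min_le_right _ _).trans (csInf_le (hfin _).bddBelow ⟨f, hf, rfl⟩)
  obtain ⟨G, hG, hGS, hp⟩ := build_tree W hW S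
  have hreach : ∀ {u v : V} (p : G.Walk u v) (hu : u ∈ S) (hv : v ∈ S),
      (G.comap (Subtype.val : S → V)).Reachable ⟨u, hu⟩ ⟨v, hv⟩ := by
    intro u v p
    induction p with
    | nil => intro _ _; exact Reachable.refl _
    | cons h p ih =>
      intro hu hv
      have hx := (hGS _ _ h).2
      refine Reachable.trans ?_ (ih hx hv)
      exact Adj.reachable (by simpa using h)
  refine ⟨S, subset_rfl, G.comap (Subtype.val : S → V), fun e => W (e.map Subtype.val),
    ⟨?_, ?_⟩, by omega, ?_⟩
  · obtain ⟨a, ha⟩ : S.Nonempty := Finset.card_pos.1 (by omega)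
    have : Nonempty S := ⟨⟨a, ha⟩⟩
    refine ⟨?_⟩
    rintro ⟨u, hu⟩ ⟨v, hv⟩
    by_cases huv : u = v
    · subst huv; exact Reachable.refl _
    · obtain ⟨p, _⟩ := hp u hu v hv huv
      exact hreach p hu hv
  · exact hG.comap (Hom.comap _ _) Subtype.val_injective
  · intro u v hu hv p q hpp hq
    by_cases huv : u = v
    · subst huv
      rw [Walk.isPath_iff_eq_nil] at hpp hq
      subst hpp hq
      simp
    · obtain ⟨r, hr, hl⟩ := hp u hu v hv huv
      have h1 : (q.map (Hom.comap (Subtype.val : S → V) G)).IsPath :=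
        Walk.map_isPath_of_injective Subtype.val_injective hq
      have h2 : q.map (Hom.comap (Subtype.val : S → V) G) = r :=
        congrArg Subtype.val (hG.path_unique ⟨_, h1⟩ ⟨r, hr⟩)
      have h3 : {x : ℝ | ∃ f ∈ q.edges, W (f.map Subtype.val) = x}
          = {x : ℝ | ∃ f ∈ r.edges, W f = x} := by
        have h5 : r.edges = q.edges.map (Sym2.map Subtype.val) := by
          rw [← h2]
          exact Walk.edges_map _ _
        rw [h5]
        ext x
        simp only [Set.mem_setOf_eq, List.mem_map]
        constructor
        · rintro ⟨f, hf, hx⟩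
          exact ⟨_, ⟨f, hf, rfl⟩, hx⟩
        · rintro ⟨_, ⟨f, hf, rfl⟩, hx⟩
          exact ⟨f, hf, hx⟩
      rw [h3, hl.csInf_eq, hWm, huniq p hpp]
end

section
/- Let G be a finite connected undirected graph with positive real edge weights, total edge weight W, and minimum cut weight c. Let G' be the graph obtained from G by replacing each vertex v of degree d(v) ≥ 3 by a cycle on d(v) new vertices in which every cycle edge has weight M > W, and reattaching each of the d(v) edges formerly incident to v to a distinct vertex of this cycle (vertices of degree at most 2 are left unchanged). Then G' has maximum degree 3 and the minimum cut weight of G' equals c. -/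
open SimpleGraph

theorem cutWeight_nonneg_aux {V : Type*} (G : SimpleGraph V) (w : Sym2 V → ℝ)
    (hw : ∀ f ∈ G.edgeSet, 0 ≤ w f) (S : Set V) : 0 ≤ cutWeight G w S := by
  unfold cutWeight wSet
  exact finsum_mem_induction (fun r : ℝ => 0 ≤ r) le_rfl (fun _ _ => add_nonneg)
    (fun f hf => hw f hf.1)

theorem wSet_mono_aux {V : Type*} [Finite V] (w : Sym2 V → ℝ) (A B : Set (Sym2 V))
    (hAB : A ⊆ B) (hw : ∀ f ∈ B, 0 ≤ w f) : wSet w A ≤ wSet w B := by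
  classical
  unfold wSet
  rw [finsum_mem_eq_finite_toFinset_sum _ (Set.toFinite A),
    finsum_mem_eq_finite_toFinset_sum _ (Set.toFinite B)]
  apply Finset.sum_le_sum_of_subset_of_nonneg
  · simpa using hAB
  · intro f hf _
    exact hw f (by simpa using hf)

theorem stmt19 {V V' : Type*} [Fintype V] [Fintype V'] [DecidableEq V] [DecidableEq V']
    (G : SimpleGraph V) [DecidableRel G.Adj]
    (G' : SimpleGraph V') [DecidableRel G'.Adj]
    (w : Sym2 V → ℝ) (w' : Sym2 V' → ℝ)
    (hG : G.Connected) (hw : ∀ f ∈ G.edgeSet, 0 < w f)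
    (M : ℝ) (hM : (∑ᶠ f ∈ G.edgeSet, w f) < M)
    (π : V' → V)
    -- vertices of degree at most 2 are left unchanged: their fiber is a single vertex
    (hsmall : ∀ v : V, G.degree v ≤ 2 → ∃! x : V', π x = v)
    -- a vertex of degree `d(v) ≥ 3` is replaced by a cycle on `d(v)` new vertices:
    -- its fiber has `d(v)` elements and induces a connected 2-regular graph (a cycle)
    (hbig : ∀ v : V, 3 ≤ G.degree v →
      (π ⁻¹' {v}).ncard = G.degree v ∧
      (G'.induce (π ⁻¹' {v})).Connected ∧
      ∀ x : π ⁻¹' {v}, ((G'.induce (π ⁻¹' {v})).neighborSet x).ncard = 2)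
    -- every intra-fiber edge is a cycle edge of weight `M`
    (hcyc : ∀ x y : V', G'.Adj x y → π x = π y →
      w' s(x, y) = M ∧ 3 ≤ G.degree (π x))
    -- the inter-fiber edges of `G'` correspond bijectively (via `π`) to the edges of `G`
    (hedges : Set.BijOn (Sym2.map π)
      {f | f ∈ G'.edgeSet ∧ ∃ x y : V', f = s(x, y) ∧ π x ≠ π y} G.edgeSet)
    -- corresponding edges keep their original weight
    (hwt : ∀ f ∈ G'.edgeSet, (∃ x y : V', f = s(x, y) ∧ π x ≠ π y) →
      w' f = w (Sym2.map π f))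
    -- the reattached edges go to distinct vertices of the cycle:
    -- each cycle vertex carries at most one inter-fiber edge
    (hattach : ∀ x : V', 3 ≤ G.degree (π x) →
      ({y : V' | G'.Adj x y ∧ π y ≠ π x}).ncard ≤ 1) :
    (∀ x : V', G'.degree x ≤ 3) ∧ minCut G' w' = minCut G w := by
  classical
  have hwn : ∀ f ∈ G.edgeSet, 0 ≤ w f := fun f hf => (hw f hf).le
  have hW0 : 0 ≤ wSet w G.edgeSet := by
    have := wSet_mono_aux w ∅ G.edgeSet (by simp) hwn
    simpa [wSet] using this
  have hWM : wSet w G.edgeSet < M := hM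
  have hwn' : ∀ f ∈ G'.edgeSet, 0 ≤ w' f := by
    intro f hf
    induction f using Sym2.ind with
    | _ x y =>
      by_cases h : π x = π y
      · rw [(hcyc x y hf h).1]; linarith
      · rw [hwt _ hf ⟨x, y, rfl, h⟩]
        exact hwn _ (hedges.mapsTo ⟨hf, x, y, rfl, h⟩)
  have hsurj : Function.Surjective π := by
    intro v
    by_cases h : G.degree v ≤ 2
    · exact (hsmall v h).exists
    · obtain ⟨x⟩ := (hbig v (by omega)).2.1.nonempty
      exact ⟨x.1, x.2⟩
  have hcutle : ∀ S, cutWeight G w S ≤ wSet w G.edgeSet := fun S =>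
    wSet_mono_aux w _ _ (fun f hf => hf.1) hwn
  -- saturated cuts keep their weight
  have hpre : ∀ S : Set V, cutWeight G' w' (π ⁻¹' S) = cutWeight G w S := by
    intro S
    unfold cutWeight wSet
    have hsub : crossEdges G' (π ⁻¹' S) ⊆
        {f | f ∈ G'.edgeSet ∧ ∃ x y : V', f = s(x, y) ∧ π x ≠ π y} := by
      rintro f ⟨hf, x, y, rfl, hx, hy⟩
      refine ⟨hf, x, y, rfl, fun h => hy ?_⟩
      simpa [h] using hx
    refine finsum_mem_eq_of_bijOn (Sym2.map π) ⟨?_, hedges.injOn.mono hsub, ?_⟩ ?_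
    · intro f hf
      refine ⟨hedges.mapsTo (hsub hf), ?_⟩
      obtain ⟨_, x, y, rfl, hx, hy⟩ := hf
      exact ⟨π x, π y, by simp, hx, hy⟩
    · rintro f ⟨hf, a, b, rfl, ha, hb⟩
      obtain ⟨f', ⟨hf', x, y, rfl, hxy⟩, he⟩ := hedges.surjOn hf
      refine ⟨s(x, y), ⟨hf', ?_⟩, he⟩
      rw [Sym2.map_mk, Sym2.eq_iff] at he
      rcases he with ⟨h1, h2⟩ | ⟨h1, h2⟩
      · exact ⟨x, y, rfl, by simpa [h1] using ha, by simpa [h2] using hb⟩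
      · exact ⟨y, x, Sym2.eq_swap, by simpa [h2] using ha, by simpa [h1] using hb⟩
    · intro f hf
      exact hwt f hf.1 (hsub hf).2
  -- dichotomy for cuts of `G'`
  have hdich : ∀ S' : Set V', S'.Nonempty → S' ≠ Set.univ →
      ∃ S : Set V, S.Nonempty ∧ S ≠ Set.univ ∧ cutWeight G w S ≤ cutWeight G' w' S' := by
    intro S' hne hnu
    by_cases hsat : ∀ x y, π x = π y → x ∈ S' → y ∈ S'
    · have hS : π ⁻¹' (π '' S') = S' := by
        ext y
        constructor
        · rintro ⟨x, hx, hxy⟩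
          exact hsat x y hxy hx
        · intro hy
          exact ⟨y, hy, rfl⟩
      refine ⟨π '' S', hne.image π, ?_, ?_⟩
      · intro h
        apply hnu
        rw [← hS, h, Set.preimage_univ]
      · rw [← hpre, hS]
    · push Not at hsat
      obtain ⟨x, y, hxy, hx, hy⟩ := hsat
      have hd : 3 ≤ G.degree (π x) := by
        by_contra hlt
        have := (hsmall (π x) (by omega)).unique rfl hxy.symm
        exact hy (this ▸ hx)
      obtain ⟨-, hconn, -⟩ := hbig (π x) hd
      obtain ⟨p⟩ := hconn.preconnected ⟨x, rfl⟩ ⟨y, hxy.symm⟩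
      obtain ⟨d, -, hd1, hd2⟩ := p.exists_boundary_dart {z | z.1 ∈ S'} hx hy
      have hadj : G'.Adj d.fst.1 d.snd.1 := d.adj
      have hf1 : π d.fst.1 = π x := d.fst.2
      have hf2 : π d.snd.1 = π x := d.snd.2
      have hwe := (hcyc _ _ hadj (hf1.trans hf2.symm)).1
      refine ⟨{π x}, Set.singleton_nonempty _, ?_, ?_⟩
      · intro h
        have hpos : 0 < G.degree (π x) := by omega
        obtain ⟨u, hu⟩ := (G.degree_pos_iff_exists_adj _).1 hpos
        have : u ∈ ({π x} : Set V) := h ▸ Set.mem_univ u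
        exact hu.ne (by simpa using this.symm)
      · have h1 := wSet_mono_aux w' {s(d.fst.1, d.snd.1)} (crossEdges G' S')
          (by
            rintro f rfl
            exact ⟨hadj, _, _, rfl, hd1, hd2⟩)
          (fun f hf => hwn' f hf.1)
        have h2 : wSet w' {s(d.fst.1, d.snd.1)} = M := by
          unfold wSet
          rw [finsum_mem_singleton, hwe]
        have h3 := hcutle {π x}
        unfold cutWeight at h3 ⊢
        linarith
  refine ⟨?_, ?_⟩
  · intro x
    have hdeg : G'.degree x = {y | G'.Adj x y}.ncard := by
      rw [← SimpleGraph.card_neighborSet_eq_degree, ← Nat.card_eq_fintype_card]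
      rfl
    rw [hdeg]
    by_cases h3 : 3 ≤ G.degree (π x)
    · have hsplit : {y | G'.Adj x y} =
          {y | G'.Adj x y ∧ π y = π x} ∪ {y | G'.Adj x y ∧ π y ≠ π x} := by
        ext y
        simp only [Set.mem_ofPred_eq, Set.mem_union]
        tauto
      have h2 := (hbig (π x) h3).2.2 ⟨x, rfl⟩
      have him : {y | G'.Adj x y ∧ π y = π x} = Subtype.val ''
          ((G'.induce (π ⁻¹' {π x})).neighborSet ⟨x, rfl⟩) := by
        ext y
        simp
      have h4 : {y | G'.Adj x y ∧ π y = π x}.ncard = 2 := by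
        rw [him, Set.ncard_image_of_injective _ Subtype.val_injective, h2]
      have h5 := hattach x h3
      rw [hsplit]
      have h6 := Set.ncard_union_le {y | G'.Adj x y ∧ π y = π x} {y | G'.Adj x y ∧ π y ≠ π x}
      omega
    · have hne : ∀ y, G'.Adj x y → π x ≠ π y := fun y hy h => h3 (hcyc x y hy h).2
      have hdegv : G.degree (π x) = {y | G.Adj (π x) y}.ncard := by
        rw [← SimpleGraph.card_neighborSet_eq_degree, ← Nat.card_eq_fintype_card]
        rfl
      have hle : {y | G'.Adj x y}.ncard ≤ {y | G.Adj (π x) y}.ncard := by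
        refine Set.ncard_le_ncard_of_injOn π ?_ ?_ (Set.toFinite _)
        · intro y hy
          exact hedges.mapsTo (x := s(x, y)) ⟨hy, x, y, rfl, hne y hy⟩
        · intro y hy z hz hyz
          have := hedges.injOn (x₁ := s(x, y)) ⟨hy, x, y, rfl, hne y hy⟩
            (x₂ := s(x, z)) ⟨hz, x, z, rfl, hne z hz⟩ (by simp [hyz])
          exact Sym2.congr_right.1 this
      omega
  · unfold minCut
    have hb : BddBelow (cutWeight G w '' {S : Set V | S.Nonempty ∧ S ≠ Set.univ}) :=
      ⟨0, by rintro _ ⟨S, -, rfl⟩; exact cutWeight_nonneg_aux G w hwn S⟩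
    have hb' : BddBelow (cutWeight G' w' '' {S : Set V' | S.Nonempty ∧ S ≠ Set.univ}) :=
      ⟨0, by rintro _ ⟨S, -, rfl⟩; exact cutWeight_nonneg_aux G' w' hwn' S⟩
    have hpc : ∀ S : Set V, S.Nonempty → S ≠ Set.univ →
        (π ⁻¹' S).Nonempty ∧ π ⁻¹' S ≠ Set.univ := by
      intro S h1 h2
      refine ⟨h1.preimage hsurj, fun h => h2 ?_⟩
      rw [← Set.image_preimage_eq S hsurj, h, Set.image_univ, hsurj.range_eq]
    by_cases hex : ∃ S : Set V, S.Nonempty ∧ S ≠ Set.univ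
    · obtain ⟨S₀, h1, h2⟩ := hex
      apply le_antisymm
      · refine le_csInf ⟨_, ⟨S₀, ⟨h1, h2⟩, rfl⟩⟩ ?_
        rintro _ ⟨S, ⟨h3, h4⟩, rfl⟩
        rw [← hpre]
        exact csInf_le hb' ⟨_, hpc S h3 h4, rfl⟩
      · refine le_csInf ⟨_, ⟨π ⁻¹' S₀, hpc S₀ h1 h2, rfl⟩⟩ ?_
        rintro _ ⟨S', ⟨h3, h4⟩, rfl⟩
        obtain ⟨S, h5, h6, h7⟩ := hdich S' h3 h4
        exact (csInf_le hb ⟨S, ⟨h5, h6⟩, rfl⟩).trans h7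
    · have e1 : {S : Set V | S.Nonempty ∧ S ≠ Set.univ} = ∅ := by
        ext S
        simp only [Set.mem_ofPred_eq, Set.mem_empty_iff_false, iff_false]
        exact fun h => hex ⟨S, h⟩
      have e2 : {S : Set V' | S.Nonempty ∧ S ≠ Set.univ} = ∅ := by
        ext S'
        simp only [Set.mem_ofPred_eq, Set.mem_empty_iff_false, iff_false]
        rintro ⟨h3, h4⟩
        obtain ⟨S, h5, h6, -⟩ := hdich S' h3 h4
        exact hex ⟨S, h5, h6⟩
      rw [e1, e2, Set.image_empty, Set.image_empty]
end
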